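/- arXiv:1808.05688 — 8 statements merged into one kernel-verified Lean document; each statement's English description precedes it below -/
import Mathlib

section
/- Let A be a nonempty finite set of positive integers with gcd(A) = 1 and with 1 < min A. Then there exists k ∈ ℕ, k ≥ 1, such that min(A^k) < min(A), where A^k denotes the k-th iterate of the Nash step applied to A. -/
/-- One step of the combinatorial Nash modification algorithm on a finite set of
naturals: with `m = min A`, `nash A = {m} ∪ {a - m : a ∈ A, a > m}`. -/
def nash (A : Finset ℕ) : Finset ℕ :=
  if h : A.Nonempty then
    insert (A.min' h)
      ((A.filter (fun a => A.min' h < a)).image (fun a => a - A.min' h))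
  else ∅

lemma nash_nonempty {A : Finset ℕ} (h : A.Nonempty) : (nash A).Nonempty := by
  rw [nash, dif_pos h]; exact Finset.insert_nonempty _ _

lemma nash_iter_nonempty {A : Finset ℕ} (h : A.Nonempty) (k : ℕ) :
    (nash^[k] A).Nonempty := by
  induction k with
  | zero => simpa using h
  | succ n ih => rw [Function.iterate_succ_apply']; exact nash_nonempty ih

lemma nash_aux (a : ℕ) : ∀ (A : Finset ℕ) (hA : A.Nonempty), 0 < A.min' hA → a ∈ A →
    ¬ A.min' hA ∣ a →
    ∃ k : ℕ, 1 ≤ k ∧ (nash^[k] A).min' (nash_iter_nonempty hA k) < A.min' hA := by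
  induction a using Nat.strong_induction_on with
  | _ a ih =>
    intro A hA hm ha hd
    have hle : A.min' hA ≤ a := A.min'_le a ha
    have hlt : A.min' hA < a := lt_of_le_of_ne hle (fun h => hd (h ▸ dvd_rfl))
    have hmem : A.min' hA ∈ nash A := by
      rw [nash, dif_pos hA]; exact Finset.mem_insert_self _ _
    have hmem2 : a - A.min' hA ∈ nash A := by
      rw [nash, dif_pos hA]
      exact Finset.mem_insert_of_mem
        (Finset.mem_image.2 ⟨a, Finset.mem_filter.2 ⟨ha, hlt⟩, rfl⟩)
    by_cases h1 : (nash A).min' (nash_nonempty hA) < A.min' hA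
    · exact ⟨1, le_rfl, h1⟩
    · have heq : (nash A).min' (nash_nonempty hA) = A.min' hA :=
        le_antisymm (Finset.min'_le _ _ hmem) (not_lt.1 h1)
      obtain ⟨k, hk, hk2⟩ := ih (a - A.min' hA) (by omega) (nash A) (nash_nonempty hA)
        (by rw [heq]; exact hm) hmem2
        (by rw [heq]; intro h; exact hd ((Nat.dvd_sub_iff_left hle dvd_rfl).1 h))
      rw [heq] at hk2
      exact ⟨k + 1, by omega, hk2⟩

theorem exists_iter_min_lt (A : Finset ℕ) (hA : A.Nonempty)
    (hpos : ∀ a ∈ A, 0 < a) (hgcd : A.gcd id = 1)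
    (hmin : 1 < A.min' hA) :
    ∃ k : ℕ, 1 ≤ k ∧
      (nash^[k] A).min' (nash_iter_nonempty hA k) < A.min' hA := by
  by_contra hcon
  have hall : ∀ a ∈ A, A.min' hA ∣ id a := by
    intro a ha
    by_contra hd
    exact hcon (nash_aux a A hA (by omega) ha hd)
  have := Finset.dvd_gcd hall
  rw [hgcd, Nat.dvd_one] at this
  omega
end

section
/- Let A be a nonempty finite set of positive integers with gcd(A) = 1 and with 1 < a₁ := min A. Let b be the least element of A that is not divisible by a₁ (such b exists since gcd(A) = 1 and a₁ > 1), and write b = a₁·q + r with q = b / a₁ and r = b % a₁, so 0 < r < a₁. Then min(A^k) = a₁ for every k with 0 ≤ k < q, and min(A^q) = r. -/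
/-- The invariant preserved by the first `b / a₁` Nash steps. -/
def NashInv (a t : ℕ) (S : Finset ℕ) : Prop :=
  a ∈ S ∧ t ∈ S ∧ ∀ c ∈ S, 0 < c ∧ (a ∣ c ∨ t ≤ c)

lemma NashInv.min_eq {a t : ℕ} {S : Finset ℕ} (h : NashInv a t S) (hat : a ≤ t)
    (hS : S.Nonempty) : S.min' hS = a := by
  obtain ⟨ha, -, hc⟩ := h
  refine le_antisymm (Finset.min'_le _ _ ha) (Finset.le_min' _ _ _ fun c hcS => ?_)
  obtain ⟨h0, h | h⟩ := hc c hcS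
  · exact Nat.le_of_dvd h0 h
  · omega

lemma NashInv.min_eq_right {a t : ℕ} {S : Finset ℕ} (h : NashInv a t S) (hat : t ≤ a)
    (hS : S.Nonempty) : S.min' hS = t := by
  obtain ⟨-, ht, hc⟩ := h
  refine le_antisymm (Finset.min'_le _ _ ht) (Finset.le_min' _ _ _ fun c hcS => ?_)
  obtain ⟨h0, h | h⟩ := hc c hcS
  · exact hat.trans (Nat.le_of_dvd h0 h)
  · omega

lemma NashInv.step {a t : ℕ} {S : Finset ℕ} (h : NashInv a (t + a) S) (ht : 0 < t) :
    NashInv a t (nash S) := by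
  have hS : S.Nonempty := ⟨a, h.1⟩
  have hm := h.min_eq (by omega) hS
  obtain ⟨ha, htS, hc⟩ := h
  rw [nash, dif_pos hS, hm]
  refine ⟨by simp, ?_, ?_⟩
  · refine Finset.mem_insert_of_mem (Finset.mem_image.2 ⟨t + a, ?_, by omega⟩)
    simp [htS, ht]
  · intro c hcS
    rcases Finset.mem_insert.1 hcS with rfl | hcS
    · exact ⟨(hc c ha).1, Or.inl dvd_rfl⟩
    · obtain ⟨d, hd, rfl⟩ := Finset.mem_image.1 hcS
      obtain ⟨hdS, had⟩ := Finset.mem_filter.1 hd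
      refine ⟨by omega, ?_⟩
      rcases (hc d hdS).2 with h | h
      · exact Or.inl (Nat.dvd_sub h dvd_rfl)
      · right; omega

theorem min_iter_eq_of_division (A : Finset ℕ) (hA : A.Nonempty)
    (hpos : ∀ a ∈ A, 0 < a) (hgcd : A.gcd id = 1)
    (a₁ : ℕ) (ha₁ : a₁ = A.min' hA) (h1 : 1 < a₁)
    (b : ℕ) (hbA : b ∈ A) (hbnd : ¬ a₁ ∣ b)
    (hbleast : ∀ c ∈ A, ¬ a₁ ∣ c → b ≤ c) :
    (∀ k < b / a₁,
        (nash^[k] A).min' (nash_iter_nonempty hA k) = a₁) ∧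
      (nash^[b / a₁] A).min' (nash_iter_nonempty hA (b / a₁)) = b % a₁ := by
  have h0 : NashInv a₁ b A := by
    refine ⟨ha₁ ▸ Finset.min'_mem _ _, hbA, fun c hc => ⟨hpos c hc, ?_⟩⟩
    by_cases h : a₁ ∣ c
    · exact Or.inl h
    · exact Or.inr (hbleast c hc h)
  have hr : 0 < b % a₁ := Nat.pos_of_ne_zero fun h => hbnd (Nat.dvd_of_mod_eq_zero h)
  have hlt : b % a₁ < a₁ := Nat.mod_lt _ (by omega)
  have key : ∀ k j, k + j = b / a₁ → NashInv a₁ (b % a₁ + a₁ * j) (nash^[k] A) := by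
    intro k
    induction k with
    | zero =>
      intro j hj
      have : j = b / a₁ := by omega
      subst this
      rw [Nat.mod_add_div]
      exact h0
    | succ n ih =>
      intro j hj
      rw [Function.iterate_succ_apply']
      refine NashInv.step ?_ (by omega)
      have := ih (j + 1) (by omega)
      rwa [mul_add, mul_one, ← add_assoc] at this
  refine ⟨fun k hk => ?_, ?_⟩
  · obtain ⟨j, hj⟩ : ∃ j, k + (j + 1) = b / a₁ := ⟨b / a₁ - k - 1, by omega⟩
    refine (key k (j + 1) hj).min_eq ?_ _
    rw [mul_add]; omega
  · have := key (b / a₁) 0 rfl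
    rw [mul_zero, add_zero] at this
    exact this.min_eq_right hlt.le _
end

section
/- Let A be a nonempty finite set of positive integers with gcd(A) = 1 and with 1 < min A. Then v(N(A)) ≤ v(A) − 2, where N(A) is the Nash step of A and v(S) := min { a ∈ S : gcd { b ∈ S : b ≤ a } = 1 } for any nonempty finite set S of positive integers with gcd(S) = 1. -/
/-- `v S` = least `a ∈ S` such that the gcd of `{b ∈ S : b ≤ a}` is `1`. -/
noncomputable def v (S : Finset ℕ) : ℕ :=
  sInf { a : ℕ | a ∈ S ∧ (S.filter fun b => b ≤ a).gcd id = 1 }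

theorem v_nash_le (A : Finset ℕ) (hA : A.Nonempty)
    (hpos : ∀ a ∈ A, 0 < a) (hgcd : A.gcd id = 1)
    (hmin : 1 < A.min' hA) :
    v (nash A) ≤ v A - 2 := by
  have hw : v A ∈ { a : ℕ | a ∈ A ∧ (A.filter fun b => b ≤ a).gcd id = 1 } := by
    apply Nat.sInf_mem
    refine ⟨A.max' hA, A.max'_mem hA, ?_⟩
    rw [Finset.filter_true_of_mem (fun b hb => A.le_max' b hb)]
    exact hgcd
  have hmem : ∀ x, x ∈ nash A ↔ x = A.min' hA ∨ ∃ a ∈ A, A.min' hA < a ∧ a - A.min' hA = x := by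
    intro x
    rw [nash, dif_pos hA]
    simp [and_assoc]
  have hminmem := A.min'_mem hA
  have hle : ∀ a ∈ A, A.min' hA ≤ a := fun a ha => A.min'_le a ha
  generalize A.min' hA = m at *
  generalize v A = w at *
  obtain ⟨hwA, hwg⟩ := hw
  have hmw : m < w := by
    rcases (hle w hwA).lt_or_eq with h | h
    · exact h
    · exfalso
      have : m ∣ (A.filter fun b => b ≤ w).gcd id := by
        apply Finset.dvd_gcd
        intro b hb
        rw [Finset.mem_filter] at hb
        have := hle b hb.1
        have : b = m := by omega
        simp [this]
      rw [hwg, Nat.dvd_one] at this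
      omega
  have key : ∀ a, a ∈ nash A → (∀ d, (∀ x ∈ nash A, x ≤ a → d ∣ x) → d ∣ 1) → v (nash A) ≤ a := by
    intro a ha hd
    apply Nat.sInf_le
    refine ⟨ha, Nat.dvd_one.1 (hd _ ?_)⟩
    intro x hx hxa
    exact Finset.gcd_dvd (f := id) (Finset.mem_filter.2 ⟨hx, hxa⟩)
  have hwm : w - m ∈ nash A := (hmem _).2 (Or.inr ⟨w, hwA, hmw, rfl⟩)
  have hm : m ∈ nash A := (hmem _).2 (Or.inl rfl)
  by_cases hc : w = m + 1
  · have h1 : w - m = 1 := by omega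
    rw [h1] at hwm
    have := key 1 hwm (fun d hd => hd 1 hwm le_rfl)
    omega
  · have := key (max m (w - m)) (by rcases max_choice m (w - m) with h | h <;> rw [h] <;> assumption) (by
      intro d hd
      have hdm : d ∣ m := hd m hm (le_max_left _ _)
      rw [← hwg]
      apply Finset.dvd_gcd
      intro b hb
      rw [Finset.mem_filter] at hb
      have hmb := hle b hb.1
      rcases hmb.lt_or_eq with h | h
      · have h2 : d ∣ b - m := hd (b - m) ((hmem _).2 (Or.inr ⟨b, hb.1, h, rfl⟩))
          (le_max_of_le_right (by omega))
        have h3 := dvd_add h2 hdm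
        rwa [Nat.sub_add_cancel hmb] at h3
      · simpa [← h] using hdm)
    omega
end

section
/- Let A be a nonempty finite set of positive integers with gcd(A) = 1 and with 1 < min A. Then there exists k ≤ ⌊v(A)/2⌋ with 1 ∈ A^k; equivalently, η(A) ≤ ⌊v(A)/2⌋, where η(A) is the least k with 1 ∈ A^k and v(A) := min { a ∈ A : gcd { b ∈ A : b ≤ a } = 1 }. -/
/-- `eta A` = least number of Nash steps after which `1` appears. -/
noncomputable def eta (A : Finset ℕ) : ℕ :=
  sInf { k : ℕ | 1 ∈ nash^[k] A }

lemma nash_key : ∀ (w : ℕ) (A : Finset ℕ), A.Nonempty → (∀ a ∈ A, 0 < a) →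
    (∀ d : ℕ, (∀ b ∈ A, b ≤ w → d ∣ b) → d = 1) →
    ∃ k : ℕ, k ≤ w / 2 ∧ 1 ∈ nash^[k] A := by
  intro w
  induction w using Nat.strong_induction_on with
  | _ w ih =>
  intro A hA hpos hd
  by_cases h1 : 1 ∈ A
  · exact ⟨0, Nat.zero_le _, by simpa using h1⟩
  obtain ⟨m, hm⟩ : ∃ m, m = A.min' hA := ⟨_, rfl⟩
  have hmA : m ∈ A := hm ▸ A.min'_mem hA
  have hle : ∀ a ∈ A, m ≤ a := fun a ha => hm ▸ A.min'_le a ha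
  have hm2 : 2 ≤ m := by
    have := hpos m hmA
    have : m ≠ 1 := fun h => h1 (h ▸ hmA)
    omega
  have hmem : ∀ x, x ∈ nash A ↔ x = m ∨ ∃ a ∈ A, m < a ∧ a - m = x := by
    intro x
    rw [nash, dif_pos hA, ← hm]
    simp [and_assoc]
  have hmw : m ≤ w := by
    by_contra hlt
    have := hd 0 (fun b hb hbw => absurd (hle b hb) (by omega))
    omega
  by_cases hw : w ≤ m + 1
  · have hm1 : m + 1 ∈ A := by
      by_contra hno
      have := hd m (fun b hb hbw => by
        have h2 := hle b hb
        have h3 : b ≠ m + 1 := fun h => hno (h ▸ hb)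
        have : b = m := by omega
        rw [this])
      omega
    refine ⟨1, by omega, ?_⟩
    simp only [Function.iterate_one]
    exact (hmem 1).2 (Or.inr ⟨m + 1, hm1, by omega, by omega⟩)
  · obtain ⟨k, hk, hk1⟩ := ih (w - 2) (by omega) (nash A) (nash_nonempty hA)
      (by
        intro x hx
        rcases (hmem x).1 hx with h | ⟨a, _, h, h'⟩ <;> omega)
      (by
        intro d hdd
        have hdm : d ∣ m := hdd m ((hmem m).2 (Or.inl rfl)) (by omega)
        refine hd d (fun b hb hbw => ?_)
        rcases (hle b hb).eq_or_lt with h | h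
        · exact h ▸ hdm
        · have := hdd (b - m) ((hmem _).2 (Or.inr ⟨b, hb, h, rfl⟩)) (by omega)
          have h2 := dvd_add this hdm
          rwa [Nat.sub_add_cancel h.le] at h2)
    exact ⟨k + 1, by omega, by rwa [Function.iterate_succ_apply]⟩

theorem eta_le_half_v (A : Finset ℕ) (hA : A.Nonempty)
    (hpos : ∀ a ∈ A, 0 < a) (hgcd : A.gcd id = 1)
    (hmin : 1 < A.min' hA) :
    (∃ k : ℕ, k ≤ v A / 2 ∧ 1 ∈ nash^[k] A) ∧ eta A ≤ v A / 2 := by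
  have hv : v A ∈ { a : ℕ | a ∈ A ∧ (A.filter fun b => b ≤ a).gcd id = 1 } := by
    apply Nat.sInf_mem
    refine ⟨A.max' hA, A.max'_mem hA, ?_⟩
    rw [Finset.filter_true_of_mem (fun b hb => A.le_max' b hb)]
    exact hgcd
  have key := nash_key (v A) A hA hpos (by
    intro d hd
    have : d ∣ (A.filter fun b => b ≤ v A).gcd id := by
      apply Finset.dvd_gcd
      intro b hb
      rw [Finset.mem_filter] at hb
      exact hd b hb.1 hb.2
    rw [hv.2] at this
    exact Nat.dvd_one.1 this)
  refine ⟨key, ?_⟩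
  obtain ⟨k, hk, hk1⟩ := key
  have h : eta A ≤ k := Nat.sInf_le (show k ∈ { k : ℕ | 1 ∈ nash^[k] A } from hk1)
  exact h.trans hk
end

section
/- Let A be a nonempty finite set of positive integers with gcd(A) = 1 and with 1 < a₁ := min A, and let a₂ := min(A \ {a₁}) be the second smallest element of A (A has at least two elements since gcd(A) = 1 and a₁ > 1). Then a₁ ≥ F(δ(A) + 1) and a₂ ≥ F(δ(A) + 2), where F is the Fibonacci sequence with F(1) = 1, F(2) = 2, F(m+2) = F(m+1) + F(m), and δ(A) is the number of division algorithms occurring in the Nash algorithm for A. -/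
/-- `delta A` = number of strict drops of the minimum along the Nash algorithm,
i.e. the number of division algorithms into which it decomposes. -/
noncomputable def delta (A : Finset ℕ) : ℕ :=
  ((Finset.Icc 1 (eta A)).filter
    (fun k => (nash^[k] A).min < (nash^[k - 1] A).min)).card

/-- Fibonacci sequence normalized by `F 1 = 1`, `F 2 = 2`,
`F (m+2) = F (m+1) + F m`. -/
def F (n : ℕ) : ℕ := Nat.fib (n + 1)

lemma mem_nash {A : Finset ℕ} {a : ℕ} (ha : a ∈ A) (hmin : ∀ x ∈ A, a ≤ x) (x : ℕ) :
    x ∈ nash A ↔ x = a ∨ (x + a ∈ A ∧ 0 < x) := by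
  have hA : A.Nonempty := ⟨a, ha⟩
  have hm : A.min' hA = a :=
    le_antisymm (A.min'_le a ha) (hmin _ (A.min'_mem hA))
  rw [nash, dif_pos hA, hm]
  simp only [Finset.mem_insert, Finset.mem_image, Finset.mem_filter]
  constructor
  · rintro (h | ⟨b, ⟨hb, hab⟩, rfl⟩)
    · exact Or.inl h
    · right
      rw [Nat.sub_add_cancel hab.le]
      exact ⟨hb, by omega⟩
  · rintro (h | ⟨h, h0⟩)
    · exact Or.inl h
    · right
      exact ⟨x + a, ⟨h, by omega⟩, by omega⟩

lemma nash_singleton (m : ℕ) : nash {m} = {m} := by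
  ext x
  rw [mem_nash (Finset.mem_singleton_self m) (by simp)]
  simp

lemma nash_iter_singleton (m k : ℕ) : nash^[k] {m} = {m} := by
  induction k with
  | zero => rfl
  | succ k ih => rw [Function.iterate_succ_apply', ih, nash_singleton]

lemma two_smallest {A : Finset ℕ} {c d : ℕ} (hc : c ∈ A) (hd : d ∈ A) (hcd : c ≠ d) :
    ∃ a b, a ∈ A ∧ b ∈ A ∧ a < b ∧ ∀ x ∈ A, x = a ∨ b ≤ x := by
  have hA : A.Nonempty := ⟨c, hc⟩
  have hE : (A.erase (A.min' hA)).Nonempty := by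
    by_cases h : c = A.min' hA
    · exact ⟨d, Finset.mem_erase.2 ⟨by rw [← h]; exact hcd.symm, hd⟩⟩
    · exact ⟨c, Finset.mem_erase.2 ⟨h, hc⟩⟩
  have hb := (A.erase (A.min' hA)).min'_mem hE
  refine ⟨A.min' hA, (A.erase (A.min' hA)).min' hE, A.min'_mem hA,
    Finset.mem_of_mem_erase hb, ?_, ?_⟩
  · exact lt_of_le_of_ne (A.min'_le _ (Finset.mem_of_mem_erase hb))
      (Finset.ne_of_mem_erase hb).symm
  · intro x hx
    by_cases h : x = A.min' hA
    · exact Or.inl h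
    · exact Or.inr (Finset.min'_le _ _ (Finset.mem_erase.2 ⟨h, hx⟩))

lemma eta_mem {A : Finset ℕ} {n : ℕ} (h : eta A = n + 1) : 1 ∈ nash^[n] (nash A) := by
  have hne : {k : ℕ | 1 ∈ nash^[k] A}.Nonempty := by
    by_contra hc
    rw [Set.not_nonempty_iff_eq_empty] at hc
    rw [eta, hc] at h
    simp at h
  have := Nat.sInf_mem hne
  rw [← eta, h] at this
  exact this

lemma eta_nash {A : Finset ℕ} {n : ℕ} (h : eta A = n + 1) : eta (nash A) = n := by
  have h1 := eta_mem h
  have h0 : eta (nash A) ≤ n := Nat.sInf_le (s := {k : ℕ | 1 ∈ nash^[k] (nash A)}) h1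
  apply le_antisymm h0
  have h2 : 1 ∈ nash^[eta (nash A)] (nash A) :=
    Nat.sInf_mem (s := {k : ℕ | 1 ∈ nash^[k] (nash A)}) ⟨n, h1⟩
  have h3 : eta A ≤ eta (nash A) + 1 := Nat.sInf_le (s := {k : ℕ | 1 ∈ nash^[k] A}) h2
  omega

lemma delta_eq (A : Finset ℕ) : delta A =
    ∑ i ∈ Finset.range (eta A),
      if (nash^[i + 1] A).min < (nash^[i] A).min then 1 else 0 := by
  have h := Finset.sum_Ico_add'
    (fun k => if (nash^[k] A).min < (nash^[k - 1] A).min then 1 else 0) 0 (eta A) 1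
  rw [delta, Finset.card_filter, Finset.range_eq_Ico]
  exact h.symm

lemma delta_nash {A : Finset ℕ} {n : ℕ} (h : eta A = n + 1) :
    delta A = delta (nash A) + if (nash A).min < A.min then 1 else 0 := by
  rw [delta_eq, delta_eq, h, eta_nash h, Finset.sum_range_succ']
  rfl

lemma min_eq {A : Finset ℕ} {a : ℕ} (ha : a ∈ A) (hmin : ∀ x ∈ A, a ≤ x) :
    A.min = WithTop.some a :=
  le_antisymm (Finset.min_le ha) (Finset.le_min fun x hx => WithTop.coe_le_coe.2 (hmin x hx))

lemma fib_aux (n : ℕ) : ∀ (A : Finset ℕ) (a b : ℕ), eta A = n → a ∈ A → b ∈ A → a < b →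
    (∀ x ∈ A, x = a ∨ b ≤ x) → 1 < a →
    F (delta A + 1) ≤ a ∧ F (delta A + 2) ≤ b := by
  induction n with
  | zero =>
    intro A a b h ha hb hab hx h1
    rw [delta_eq, h]
    simp [F, Nat.fib_add_two]
    omega
  | succ n ih =>
    intro A a b h ha hb hab hx h1
    have hmin : ∀ x ∈ A, a ≤ x := fun x hxA => by
      rcases hx x hxA with h | h <;> omega
    have hd := delta_nash h
    have hη := eta_nash h
    have hm := eta_mem h
    have key := mem_nash ha hmin
    have haB : a ∈ nash A := (key a).2 (Or.inl rfl)
    have hbB : b - a ∈ nash A :=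
      (key _).2 (Or.inr ⟨by rw [Nat.sub_add_cancel hab.le]; exact hb, by omega⟩)
    by_cases h1B : 1 ∈ nash A
    · have h0 : eta (nash A) = 0 := Nat.le_zero.1 (Nat.sInf_le (s := {k : ℕ | 1 ∈ nash^[k] (nash A)}) h1B)
      have hdB : delta (nash A) = 0 := by rw [delta_eq, h0]; rfl
      rw [hdB] at hd
      split_ifs at hd <;> rw [hd] <;> simp [F, Nat.fib_add_two] <;> omega
    · have hex : ∃ d ∈ nash A, a ≠ d := by
        by_contra! hc
        have hs : nash A = {a} := by
          ext x
          rw [Finset.mem_singleton]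
          exact ⟨fun hx => (hc x hx).symm, fun hx => hx ▸ haB⟩
        rw [hs, nash_iter_singleton, Finset.mem_singleton] at hm
        omega
      obtain ⟨d, hdB, had⟩ := hex
      obtain ⟨b₁, b₂, hb₁, hb₂, hlt, hall⟩ := two_smallest haB hdB had
      have hb₁1 : 1 < b₁ := by
        have hne : b₁ ≠ 1 := fun hh => h1B (hh ▸ hb₁)
        rcases (key b₁).1 hb₁ with hh | hh <;> omega
      obtain ⟨i1, i2⟩ := ih (nash A) b₁ b₂ hη hb₁ hb₂ hlt hall hb₁1
      have hminB : ∀ x ∈ nash A, b₁ ≤ x := fun x hxB => by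
        rcases hall x hxB with h | h <;> omega
      have hb₁' : b₁ = a ∨ b - a ≤ b₁ := by
        rcases (key b₁).1 hb₁ with hh | hh
        · exact Or.inl hh
        · right
          rcases hx _ hh.1 with h' | h' <;> omega
      have e1 := hall a haB
      have e2 := hall _ hbB
      have e3 := hminB a haB
      have e4 := hminB _ hbB
      rw [min_eq hb₁ hminB, min_eq ha hmin] at hd
      simp only [WithTop.coe_lt_coe] at hd
      have f1 : F (delta (nash A) + 2) = F (delta (nash A)) + F (delta (nash A) + 1) :=
        Nat.fib_add_two
      have f2 : F (delta (nash A) + 3) = F (delta (nash A) + 1) + F (delta (nash A) + 2) :=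
        Nat.fib_add_two
      have f3 : F (delta (nash A)) ≤ F (delta (nash A) + 1) := Nat.fib_le_fib_succ
      split_ifs at hd with hc
      · rw [hd]
        change F (delta (nash A) + 2) ≤ a ∧ F (delta (nash A) + 3) ≤ b
        omega
      · rw [hd]
        change F (delta (nash A) + 1) ≤ a ∧ F (delta (nash A) + 2) ≤ b
        omega

theorem fib_le_of_delta (A : Finset ℕ) (hA : A.Nonempty)
    (hpos : ∀ a ∈ A, 0 < a) (hgcd : A.gcd id = 1)
    (a₁ : ℕ) (ha₁ : a₁ = A.min' hA) (h1 : 1 < a₁)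
    (a₂ : ℕ) (ha₂ : a₂ = sInf { x : ℕ | x ∈ A ∧ x ≠ a₁ }) :
    F (delta A + 1) ≤ a₁ ∧ F (delta A + 2) ≤ a₂ := by
  have ha : a₁ ∈ A := ha₁ ▸ A.min'_mem hA
  have hne : { x : ℕ | x ∈ A ∧ x ≠ a₁ }.Nonempty := by
    by_contra hc
    have hs : A = {a₁} := by
      ext x
      rw [Finset.mem_singleton]
      refine ⟨fun hx => ?_, fun hx => hx ▸ ha⟩
      by_contra hxa
      exact hc ⟨x, hx, hxa⟩
    rw [hs] at hgcd
    simp at hgcd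
    omega
  have hmem := Nat.sInf_mem hne
  rw [← ha₂] at hmem
  have hle : a₁ ≤ a₂ := ha₁ ▸ A.min'_le _ hmem.1
  refine fib_aux _ A a₁ a₂ rfl ha hmem.1 (lt_of_le_of_ne hle hmem.2.symm) ?_ h1
  intro x hx
  by_cases h : x = a₁
  · exact Or.inl h
  · right
    rw [ha₂]
    exact Nat.sInf_le ⟨hx, h⟩
end

section
/- Let k ≥ 1 and m ∈ ℕ with m ≥ 5k. Then F(m+1) ≥ 10^k (that is, F(m+1) has at least k+1 digits in base 10), where F is the Fibonacci sequence with F(1) = 1, F(2) = 2, F(m+2) = F(m+1) + F(m). -/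
theorem fib_ge_ten_pow (k m : ℕ) (hk : 1 ≤ k) (hm : 5 * k ≤ m) :
    10 ^ k ≤ F (m + 1) := by
  have key : ∀ j : ℕ, 10 ^ j ≤ Nat.fib (5 * j + 2) := by
    intro j
    induction j with
    | zero => simp
    | succ j ih =>
      have e : 5 * (j + 1) + 2 = 5 * j + 7 := by ring
      have h2 := Nat.fib_add_two (n := 5 * j)
      have h3 := Nat.fib_add_two (n := 5 * j + 1)
      have h4 := Nat.fib_add_two (n := 5 * j + 2)
      have h5 := Nat.fib_add_two (n := 5 * j + 3)
      have h6 := Nat.fib_add_two (n := 5 * j + 4)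
      have h7 := Nat.fib_add_two (n := 5 * j + 5)
      have hle : Nat.fib (5 * j) ≤ Nat.fib (5 * j + 1) := Nat.fib_le_fib_succ
      rw [e, pow_succ]
      simp only [Nat.add_assoc, Nat.reduceAdd] at *
      omega
  have hmono : Nat.fib (5 * k + 2) ≤ Nat.fib (m + 1 + 1) :=
    Nat.fib_mono (by omega)
  exact (key k).trans hmono
end

section
/- Let A be a nonempty finite set of positive integers with gcd(A) = 1 and with 1 < a₁ := min A, and let a₂ := min(A \ {a₁}). Let k₁, k₂ ≥ 1 with a₁ < 10^{k₁} and a₂ < 10^{k₂} (i.e., a₁ has at most k₁ digits and a₂ has at most k₂ digits in base 10). Then δ(A) < min(5·k₁, 5·k₂ − 1). -/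
lemma mem_nash_of_least {B : Finset ℕ} {m : ℕ} (hm : m ∈ B) (hle : ∀ x ∈ B, m ≤ x) (y : ℕ) :
    y ∈ nash B ↔ y = m ∨ ∃ a ∈ B, m < a ∧ a - m = y := by
  have hB : B.Nonempty := ⟨m, hm⟩
  have h : B.min' hB = m :=
    le_antisymm (Finset.min'_le _ _ hm) (hle _ (Finset.min'_mem _ _))
  rw [nash, dif_pos hB, h]
  simp [and_assoc]

lemma min_of_least {B : Finset ℕ} {m : ℕ} (hm : m ∈ B) (hle : ∀ x ∈ B, m ≤ x) :
    B.min = (m : WithTop ℕ) := by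
  apply le_antisymm (Finset.min_le hm)
  apply Finset.le_min
  intro x hx
  exact_mod_cast hle x hx

lemma exists_least {B : Finset ℕ} (hB : B.Nonempty) : ∃ m ∈ B, ∀ x ∈ B, m ≤ x :=
  ⟨B.min' hB, Finset.min'_mem _ _, fun x hx => Finset.min'_le _ _ hx⟩

/-- recursive drop counter -/
def dropCount : ℕ → Finset ℕ → ℕ
  | 0, _ => 0
  | n + 1, B => (if (nash B).min < B.min then 1 else 0) + dropCount n (nash B)

lemma sum_eq_dropCount (n : ℕ) : ∀ B : Finset ℕ,
    (∑ i ∈ Finset.range n,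
      if (nash^[i + 1] B).min < (nash^[i] B).min then 1 else 0) = dropCount n B := by
  induction n with
  | zero => intro B; rfl
  | succ n ih =>
    intro B
    rw [Finset.sum_range_succ', dropCount, ← ih (nash B), add_comm]
    rfl

lemma delta_eq_s9 (A : Finset ℕ) : delta A = dropCount (eta A) A := by
  rw [← sum_eq_dropCount, delta, Finset.card_filter, Finset.range_eq_Ico]
  have h := Finset.sum_Ico_add'
    (fun k => if (nash^[k] A).min < (nash^[k - 1] A).min then 1 else 0) 0 (eta A) 1
  have e : Finset.Icc 1 (eta A) = Finset.Ico (0 + 1) (eta A + 1) := by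
    ext x; simp only [Finset.mem_Icc, Finset.mem_Ico]; omega
  rw [e]
  exact h.symm

lemma key (n : ℕ) : ∀ (B : Finset ℕ) (m : ℕ), (∀ x ∈ B, 0 < x) → m ∈ B → (∀ x ∈ B, m ≤ x) →
    1 ∈ nash^[n] B →
    Nat.fib (dropCount n B + 2) ≤ m ∧ ∀ b ∈ B, m < b → Nat.fib (dropCount n B + 3) ≤ b := by
  induction n with
  | zero =>
    intro B m hpos hm hle h1
    have := hpos m hm
    refine ⟨by simpa [dropCount] using Nat.succ_le_of_lt this, fun b _ hb => ?_⟩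
    have : Nat.fib 3 = 2 := rfl
    simp only [dropCount, Nat.zero_add]
    omega
  | succ n ih =>
    intro B m hpos hm hle h1
    have mem := mem_nash_of_least hm hle
    obtain ⟨m', hm', hle'⟩ := exists_least (nash_nonempty ⟨m, hm⟩)
    have hpos' : ∀ x ∈ nash B, 0 < x := by
      intro x hx
      rcases (mem x).1 hx with rfl | ⟨a, _, h, rfl⟩
      · exact hpos _ hm
      · omega
    have hmm : m ∈ nash B := (mem m).2 (Or.inl rfl)
    have hsub : ∀ b ∈ B, m < b → b - m ∈ nash B := fun b hb h => (mem _).2 (Or.inr ⟨b, hb, h, rfl⟩)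
    obtain ⟨ha, hb⟩ := ih (nash B) m' hpos' hm' hle' h1
    have hm'm := hle' m hmm
    rw [dropCount, min_of_least hm hle, min_of_least hm' hle']
    have f3 : ∀ k, Nat.fib (k + 3) = Nat.fib (k + 1) + Nat.fib (k + 2) := fun k => Nat.fib_add_two
    by_cases hlt : m' < m
    · rw [if_pos (by exact_mod_cast hlt)]
      have hb' := hb m hmm hlt
      refine ⟨by convert hb' using 2; omega, fun b hbB hmb => ?_⟩
      have h := hle' _ (hsub b hbB hmb)
      rw [show 1 + dropCount n (nash B) + 3 = (dropCount n (nash B) + 2) + 2 by omega,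
        Nat.fib_add_two]
      rw [show dropCount n (nash B) + 2 + 1 = dropCount n (nash B) + 3 by omega]
      omega
    · have hEq : m' = m := by omega
      subst hEq
      rw [if_neg (lt_irrefl _), zero_add]
      refine ⟨ha, fun b hbB hmb => ?_⟩
      have h := hsub b hbB hmb
      rcases (hle' _ h).eq_or_lt with he | hl
      · have := f3 (dropCount n (nash B))
        have : Nat.fib (dropCount n (nash B) + 1) ≤ Nat.fib (dropCount n (nash B) + 2) :=
          Nat.fib_mono (by omega)
        omega
      · have := hb _ h hl
        omega

lemma ten_pow_le (k : ℕ) : 10 ^ (k + 1) ≤ Nat.fib (5 * (k + 1) + 2) := by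
  induction k with
  | zero => decide
  | succ k ih =>
    have h : ∀ n, Nat.fib (n + 2) = Nat.fib n + Nat.fib (n + 1) := fun n => Nat.fib_add_two
    have e : 5 * (k + 1 + 1) + 2 = 5 * k + 12 := by omega
    have e' : 5 * (k + 1) + 2 = 5 * k + 7 := by omega
    rw [e'] at ih
    rw [e, pow_succ]
    have h1 := h (5 * k + 10)
    have h2 := h (5 * k + 9)
    have h3 := h (5 * k + 8)
    have h4 := h (5 * k + 7)
    have h5 := h (5 * k + 6)
    have h6 := h (5 * k + 5)
    have h7 : Nat.fib (5 * k + 5) ≤ Nat.fib (5 * k + 6) := Nat.fib_mono (by omega)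
    simp only [add_assoc, Nat.reduceAdd] at *
    omega

theorem delta_lt_of_digits (A : Finset ℕ) (hA : A.Nonempty)
    (hpos : ∀ a ∈ A, 0 < a) (hgcd : A.gcd id = 1)
    (a₁ : ℕ) (ha₁ : a₁ = A.min' hA) (h1 : 1 < a₁)
    (a₂ : ℕ) (ha₂ : a₂ = sInf { x : ℕ | x ∈ A ∧ x ≠ a₁ })
    (k₁ k₂ : ℕ) (hk₁ : 1 ≤ k₁) (hk₂ : 1 ≤ k₂)
    (hd₁ : a₁ < 10 ^ k₁) (hd₂ : a₂ < 10 ^ k₂) :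
    delta A < min (5 * k₁) (5 * k₂ - 1) := by
  by_cases hne : { k : ℕ | 1 ∈ nash^[k] A }.Nonempty
  · have hη : 1 ∈ nash^[eta A] A := Nat.sInf_mem hne
    have hm : a₁ ∈ A := ha₁ ▸ Finset.min'_mem _ _
    have hle : ∀ x ∈ A, a₁ ≤ x := fun x hx => ha₁ ▸ Finset.min'_le _ _ hx
    obtain ⟨ka, kb⟩ := key (eta A) A a₁ hpos hm hle hη
    rw [← delta_eq_s9] at ka kb
    have hne2 : { x : ℕ | x ∈ A ∧ x ≠ a₁ }.Nonempty := by
      by_contra hcon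
      have : a₁ ∣ A.gcd id := by
        apply Finset.dvd_gcd
        intro b hb
        by_cases hba : b = a₁
        · simp [hba]
        · exact absurd ⟨b, hb, hba⟩ hcon
      rw [hgcd, Nat.dvd_one] at this
      omega
    have h2 := Nat.sInf_mem hne2
    rw [← ha₂] at h2
    have kb' := kb a₂ h2.1 (lt_of_le_of_ne (hle _ h2.1) (Ne.symm h2.2))
    obtain ⟨j₁, rfl⟩ := Nat.exists_eq_add_of_le' hk₁
    obtain ⟨j₂, rfl⟩ := Nat.exists_eq_add_of_le' hk₂
    have p1 := ten_pow_le j₁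
    have p2 := ten_pow_le j₂
    rw [lt_min_iff]
    constructor
    · by_contra hcon
      have : Nat.fib (5 * (j₁ + 1) + 2) ≤ Nat.fib (delta A + 2) := Nat.fib_mono (by omega)
      omega
    · by_contra hcon
      have : Nat.fib (5 * (j₂ + 1) + 2) ≤ Nat.fib (delta A + 3) := Nat.fib_mono (by omega)
      omega
  · have h0 : eta A = 0 := by
      rw [eta, Set.not_nonempty_iff_eq_empty.1 hne, Nat.sInf_empty]
    rw [delta_eq_s9, h0, dropCount]
    rw [lt_min_iff]
    omega
end

section
/- Let A be a nonempty finite set of positive integers with gcd(A) = 1 and with 1 < a₁ := min A, and suppose no element of A other than a₁ is divisible by a₁. Let a₂ := min(A \ {a₁}) and q := a₂ / a₁ (natural-number division, so a₂ = a₁·q + r with 0 < r < a₁). Then for every k with 0 ≤ k ≤ q one has A^k = {a₁} ∪ { a − k·a₁ : a ∈ A, a ≠ a₁ }. -/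
lemma nash_insert_of_lt (m : ℕ) (S : Finset ℕ) (hS : ∀ x ∈ S, m < x) :
    nash (insert m S) = insert m (S.image (fun a => a - m)) := by
  have hne : (insert m S).Nonempty := Finset.insert_nonempty _ _
  have hmin : (insert m S).min' hne = m := by
    apply le_antisymm
    · exact Finset.min'_le _ _ (Finset.mem_insert_self _ _)
    · apply Finset.le_min'
      intro y hy
      rcases Finset.mem_insert.1 hy with h | h
      · exact h.ge
      · exact (hS y h).le
  rw [nash, dif_pos hne, hmin]
  congr 2
  ext x
  simp only [Finset.mem_filter, Finset.mem_insert]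
  constructor
  · rintro ⟨h | h, h2⟩
    · omega
    · exact h
  · intro h
    exact ⟨Or.inr h, hS x h⟩

theorem iter_eq_of_no_multiples (A : Finset ℕ) (hA : A.Nonempty)
    (hpos : ∀ a ∈ A, 0 < a) (hgcd : A.gcd id = 1)
    (a₁ : ℕ) (ha₁ : a₁ = A.min' hA) (h1 : 1 < a₁)
    (hnodiv : ∀ a ∈ A, a ≠ a₁ → ¬ a₁ ∣ a)
    (a₂ : ℕ) (ha₂ : a₂ = sInf { x : ℕ | x ∈ A ∧ x ≠ a₁ }) :
    ∀ k ≤ a₂ / a₁,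
      nash^[k] A = insert a₁ ((A.erase a₁).image (fun a => a - k * a₁)) := by
  intro k
  induction k with
  | zero =>
    intro _
    have hm : a₁ ∈ A := ha₁ ▸ Finset.min'_mem A hA
    simp [Finset.insert_erase hm]
  | succ k ih =>
    intro hk
    rw [Function.iterate_succ_apply', ih (by omega), nash_insert_of_lt]
    · rw [Finset.image_image]
      congr 2
      funext a
      simp only [Function.comp]
      rw [Nat.sub_sub, Nat.succ_mul]
    · intro x hx
      obtain ⟨a, ha, rfl⟩ := Finset.mem_image.1 hx
      obtain ⟨hne, haA⟩ := Finset.mem_erase.1 ha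
      have h2 : a₂ ≤ a := ha₂ ▸ Nat.sInf_le ⟨haA, hne⟩
      have h3 : (k + 1) * a₁ ≤ a :=
        (Nat.mul_le_mul_right _ hk).trans ((Nat.div_mul_le_self _ _).trans h2)
      have h4 : (k + 1) * a₁ ≠ a := fun h => hnodiv a haA hne ⟨k + 1, by rw [← h, mul_comm]⟩
      rw [Nat.succ_mul] at h3 h4
      show a₁ < a - k * a₁
      omega
end
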